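/- Let I ⊆ ℝ be an interval, ω₁ = 2π, and ω₂ : I → ℂ differentiable with Im ω₂(t) > 0 for all t. Suppose that for every t ∈ I there are points p₁(t), …, p_N(t) ∈ ℂ, none in the lattice Ω(t) = {2π m₁ + m₂ω₂(t)}, coefficients L₁(t), …, L_N(t) ∈ ℂ, and a function H_t holomorphic on ℂ ∖ ⋃_j (p_j(t) + Ω(t)) such that H_t(z + 2π) = H_t(z), H_t(z + ω₂(t)) = H_t(z) − ω̇₂(t), and z ↦ H_t(z) − Σ_j L_j(t)·ζ(z − p_j(t); 2π, ω₂(t)) extends to an entire function. Then the modulus function m(t) := ω₂(t)/(4πi) is differentiable on I and satisfies ṁ(t) = (1/(4π))·Σ_{j=1}^N L_j(t). -/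

import Mathlib

open Complex Filter Topology

/-- The period lattice `Ω = {m₁ω₁ + m₂ω₂ : m₁, m₂ ∈ ℤ}`. -/
def lattice (ω₁ ω₂ : ℂ) : Set ℂ :=
  {w | ∃ m₁ m₂ : ℤ, w = (m₁ : ℂ) * ω₁ + (m₂ : ℂ) * ω₂}

/-- The nonzero lattice points, as a subtype (index of summation). -/
abbrev latticeNZ (ω₁ ω₂ : ℂ) : Type :=
  {w : ℂ // w ∈ lattice ω₁ ω₂ ∧ w ≠ 0}

/-- Weierstrass ζ-function associated with periods `(ω₁, ω₂)`. -/
noncomputable def wZeta (ω₁ ω₂ z : ℂ) : ℂ :=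
  1 / z + ∑' w : latticeNZ ω₁ ω₂, (1 / (z - (w : ℂ)) + 1 / (w : ℂ) + z / (w : ℂ) ^ 2)

/-- The general term of the Weierstrass zeta series; at `w = 0` it is `1 / z`. -/
noncomputable def zetaTerm (z w : ℂ) : ℂ := 1 / (z - w) + 1 / w + z / w ^ 2

lemma zetaTerm_zero_right (z : ℂ) : zetaTerm z 0 = 1 / z := by simp [zetaTerm]

lemma zetaTerm_sub_zetaTerm (z' z w : ℂ) :
    zetaTerm z' w - zetaTerm z w = 1 / (z' - w) - 1 / (z - w) + (z' - z) * (1 / w ^ 2) := by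
  simp only [zetaTerm]; ring

lemma norm_zetaTerm_le {z w : ℂ} (h : 2 * ‖z‖ < ‖w‖) :
    ‖zetaTerm z w‖ ≤ 2 * ‖z‖ ^ 2 * (‖w‖ ^ 3)⁻¹ := by
  have hw : 0 < ‖w‖ := by linarith [norm_nonneg z]
  have hw0 : w ≠ 0 := norm_pos_iff.mp hw
  have hle : ‖w‖ / 2 ≤ ‖z - w‖ := by
    rw [norm_sub_rev]
    exact le_trans (by linarith) (norm_sub_norm_le w z)
  have hzw : z - w ≠ 0 := norm_pos_iff.mp (by linarith)
  have heq : zetaTerm z w = z ^ 2 / (w ^ 2 * (z - w)) := by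
    simp only [zetaTerm]; field_simp; ring
  rw [heq, norm_div, norm_mul, norm_pow, norm_pow]
  calc ‖z‖ ^ 2 / (‖w‖ ^ 2 * ‖z - w‖) ≤ ‖z‖ ^ 2 / (‖w‖ ^ 2 * (‖w‖ / 2)) := by gcongr
    _ = 2 * ‖z‖ ^ 2 * (‖w‖ ^ 3)⁻¹ := by field_simp

lemma PeriodPair.summable_zetaTerm (P : PeriodPair) (z : ℂ) :
    Summable fun l : P.lattice ↦ zetaTerm z l := by
  have h : Summable fun l : P.lattice ↦ (‖l‖ ^ 3)⁻¹ := by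
    simpa only [inv_pow] using ZLattice.summable_norm_pow_inv P.lattice 3 (by simp)
  refine (h.mul_left (2 * ‖z‖ ^ 2)).of_norm_bounded_eventually ?_
  refine (isCompact_iff_finite.mp
    (isCompact_closedBall (0 : P.lattice) (2 * ‖z‖))).subset fun l hl ↦ ?_
  simp only [Metric.mem_closedBall, dist_zero_right]
  by_contra! h
  exact hl (norm_zetaTerm_le h)

lemma PeriodPair.coe_lattice (P : PeriodPair) :
    (P.lattice : Set ℂ) = _root_.lattice P.ω₁ P.ω₂ := by
  ext x
  simp [PeriodPair.mem_lattice, _root_.lattice, eq_comm]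

lemma PeriodPair.wZeta_eq_tsum (P : PeriodPair) (z : ℂ) :
    wZeta P.ω₁ P.ω₂ z = ∑' l : P.lattice, zetaTerm z l := by
  classical
  have hs : Summable ((P.lattice : Set ℂ).indicator (zetaTerm z)) :=
    summable_subtype_iff_indicator.mp (P.summable_zetaTerm z)
  have h1 : ∑' l : P.lattice, zetaTerm z l =
      ∑' w, (P.lattice : Set ℂ).indicator (zetaTerm z) w :=
    tsum_subtype (P.lattice : Set ℂ) (zetaTerm z)
  have h2 : ∑' w : latticeNZ P.ω₁ P.ω₂, zetaTerm z w =
      ∑' w, Set.indicator {w | w ∈ _root_.lattice P.ω₁ P.ω₂ ∧ w ≠ 0} (zetaTerm z) w :=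
    tsum_subtype {w | w ∈ _root_.lattice P.ω₁ P.ω₂ ∧ w ≠ 0} (zetaTerm z)
  rw [h1, hs.tsum_eq_add_tsum_ite 0, Set.indicator_of_mem (zero_mem P.lattice),
    zetaTerm_zero_right]
  change 1 / z + ∑' w : latticeNZ P.ω₁ P.ω₂, zetaTerm z w = _
  rw [h2]
  congr 2
  ext w
  rw [← P.coe_lattice]
  by_cases hw : w = 0 <;> simp [Set.indicator, hw]

lemma PeriodPair.hasSum_wZeta (P : PeriodPair) (z : ℂ) :
    HasSum (fun x : ℤ × ℤ ↦ zetaTerm z (x.2 * P.ω₁ + x.1 * P.ω₂)) (wZeta P.ω₁ P.ω₂ z) := by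
  have h := (P.summable_zetaTerm z).hasSum
  rw [← P.wZeta_eq_tsum,
    ← ((Equiv.prodComm ℤ ℤ).trans P.latticeEquivProd.symm.toEquiv).hasSum_iff] at h
  refine h.congr_fun ?_
  intro x
  simp [P.latticeEquiv_symm_apply]

/-- Mittag-Leffler expansion of a difference of cotangents, as an unconditional sum over `ℤ`. -/
lemma hasSum_inv_sub_inv_cot {x y : ℂ} (hx : x ∈ integerComplement) (hy : y ∈ integerComplement) :
    HasSum (fun m : ℤ ↦ 1 / (x - m) - 1 / (y - m))
      (Real.pi * cot (Real.pi * x) - Real.pi * cot (Real.pi * y)) := by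
  have hne : ∀ {w : ℂ}, w ∈ integerComplement → ∀ m : ℤ, w - m ≠ 0 := fun hw m ↦ by
    simpa [sub_eq_add_neg] using integerComplement_add_ne_zero hw (-m)
  have hs : Summable fun m : ℤ ↦ 1 / (x - m) - 1 / (y - m) := by
    have : Summable fun m : ℤ ↦ ((x - m) * (y - m))⁻¹ := by
      refine EisensteinSeries.summable_inv_of_isBigO_rpow_inv (a := 2) (by norm_cast) ?_
      simpa [pow_two, sub_eq_add_neg] using!
        (EisensteinSeries.linear_inv_isBigO_right 1 y).comp_neg_int.mul
          (EisensteinSeries.linear_inv_isBigO_right 1 x).comp_neg_int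
    refine (this.mul_left (y - x)).congr fun m ↦ ?_
    have := hne hx m
    have := hne hy m
    field_simp
    ring
  have h1 := (hasSum_nat_add_iff' 1).mpr hs.hasSum.nat_add_neg
  have h2 := h1.tendsto_sum_nat
  have h3 := (tendsto_logDeriv_euler_cot_sub hx).sub (tendsto_logDeriv_euler_cot_sub hy)
  have h4 := tendsto_nhds_unique (h2.congr fun N ↦ ?_) h3
  · have : ∑' m : ℤ, (1 / (x - m) - 1 / (y - m)) =
        Real.pi * cot (Real.pi * x) - Real.pi * cot (Real.pi * y) := by
      simp at h4 ⊢
      linear_combination h4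
    exact this ▸ hs.hasSum
  · rw [← Finset.sum_sub_distrib]
    refine Finset.sum_congr rfl fun j _ ↦ ?_
    simp [cotTerm]
    ring

lemma tendsto_cot_pi_mul_of_im_atTop {u : ℕ → ℂ} (hu : Tendsto (fun n ↦ (u n).im) atTop atTop) :
    Tendsto (fun n ↦ cot (Real.pi * u n)) atTop (𝓝 (-I)) := by
  have he : Tendsto (fun n ↦ exp (2 * Real.pi * I * u n)) atTop (𝓝 0) := by
    rw [tendsto_zero_iff_norm_tendsto_zero]
    simp only [norm_exp]
    refine Real.tendsto_exp_atBot.comp ?_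
    have : ∀ n, (2 * Real.pi * I * u n).re = -(2 * Real.pi) * (u n).im := fun n ↦ by simp
    simp only [this]
    exact hu.const_mul_atTop_of_neg (by linarith [Real.pi_pos])
  simp only [cot_pi_eq_exp_ratio]
  have := (he.add_const 1).div ((he.const_sub 1).const_mul I) (by simp)
  simpa [Pi.div_def] using this

lemma tendsto_cot_pi_mul_of_im_atBot {u : ℕ → ℂ} (hu : Tendsto (fun n ↦ (u n).im) atTop atBot) :
    Tendsto (fun n ↦ cot (Real.pi * u n)) atTop (𝓝 I) := by
  have := (tendsto_cot_pi_mul_of_im_atTop (u := fun n ↦ -u n)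
    (tendsto_neg_atBot_atTop.comp hu)).neg
  simpa [cot, Complex.sin_neg, Complex.cos_neg, neg_div, div_neg] using this

/-- A two-sided telescoping series sums to the difference of its limits. -/
lemma HasSum.eq_sub_of_int_telescoping {g : ℤ → ℂ} {a A B : ℂ}
    (h : HasSum (fun n ↦ g (n - 1) - g n) a)
    (hA : Tendsto (fun n : ℕ ↦ g (-n)) atTop (𝓝 A)) (hB : Tendsto (fun n : ℕ ↦ g n) atTop (𝓝 B)) :
    a = A - B := by
  have h1 := h.nat_add_neg.tendsto_sum_nat
  rw [← tendsto_add_atTop_iff_nat 1] at h1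
  have h2 : ∀ N : ℕ, ∑ n ∈ Finset.range (N + 1),
      (g (n - 1) - g n + (g (-n - 1) - g (-n))) =
      g (-1) - g N + g (-(N + 1 : ℕ)) - g 0 := by
    intro N
    induction N with
    | zero => simp; ring
    | succ k ih =>
      rw [Finset.sum_range_succ, ih]
      push_cast
      rw [show (k : ℤ) + 1 - 1 = k by ring, show -((k : ℤ) + 1) - 1 = -((k : ℤ) + 1 + 1) by ring]
      ring
  have h3 := ((hB.const_sub (g (-1))).add ((tendsto_add_atTop_iff_nat 1).mpr hA)).sub_const (g 0)
  have h4 := tendsto_nhds_unique h1 (h3.congr fun N ↦ (h2 N).symm)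
  simp at h4
  linear_combination h4

lemma PeriodPair.sub_div_mem_integerComplement (P : PeriodPair) {z : ℂ}
    (hz : z ∉ _root_.lattice P.ω₁ P.ω₂) (h₁ : P.ω₁ ≠ 0) (n : ℤ) :
    (z - n * P.ω₂) / P.ω₁ ∈ integerComplement := by
  rintro ⟨m, hm⟩
  refine hz ⟨m, n, ?_⟩
  rw [eq_div_iff h₁] at hm
  linear_combination -hm

/-- The increment of the Weierstrass zeta function, summed row by row. -/
lemma PeriodPair.hasSum_wZeta_sub (P : PeriodPair) (h₁ : P.ω₁ ≠ 0) {z z' : ℂ}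
    (hz : z ∉ _root_.lattice P.ω₁ P.ω₂) (hz' : z' ∉ _root_.lattice P.ω₁ P.ω₂) :
    HasSum (fun n : ℤ ↦
      1 / P.ω₁ * (Real.pi * cot (Real.pi * ((z' - n * P.ω₂) / P.ω₁))
        - Real.pi * cot (Real.pi * ((z - n * P.ω₂) / P.ω₁)))
      + (z' - z) * ∑' m : ℤ, 1 / ((m : ℂ) * P.ω₁ + n * P.ω₂) ^ 2)
      (wZeta P.ω₁ P.ω₂ z' - wZeta P.ω₁ P.ω₂ z) := by
  refine ((P.hasSum_wZeta z').sub (P.hasSum_wZeta z)).prod_fiberwise fun n ↦ ?_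
  simp only [zetaTerm_sub_zetaTerm]
  refine HasSum.add ?_ (HasSum.mul_left _ (Summable.hasSum ?_))
  · refine ((hasSum_inv_sub_inv_cot (P.sub_div_mem_integerComplement hz' h₁ n)
      (P.sub_div_mem_integerComplement hz h₁ n)).mul_left (1 / P.ω₁)).congr_fun fun m ↦ ?_
    have key : ∀ w : ℂ, 1 / (w - (m * P.ω₁ + n * P.ω₂)) =
        1 / P.ω₁ * (1 / ((w - n * P.ω₂) / P.ω₁ - m)) := fun w ↦ by
      rw [one_div_mul_one_div]
      congr 1
      field_simp
      ring
    rw [key, key]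
    ring
  · refine ((EisensteinSeries.linear_right_summable (P.ω₂ / P.ω₁) n (k := 2) le_rfl).mul_left
      (1 / P.ω₁ ^ 2)).congr fun m ↦ ?_
    rw [one_div, one_div, ← mul_inv]
    congr 1
    norm_cast
    rw [← mul_pow]
    congr 1
    field_simp
    ring

lemma add_fst_notMem_lattice {ω₁ ω₂ z : ℂ} (hz : z ∉ lattice ω₁ ω₂) :
    z + ω₁ ∉ lattice ω₁ ω₂ := by
  rintro ⟨m, n, h⟩
  exact hz ⟨m - 1, n, by push_cast; linear_combination h⟩

lemma add_snd_notMem_lattice {ω₁ ω₂ z : ℂ} (hz : z ∉ lattice ω₁ ω₂) :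
    z + ω₂ ∉ lattice ω₁ ω₂ := by
  rintro ⟨m, n, h⟩
  exact hz ⟨m, n - 1, by push_cast; linear_combination h⟩

/-- Quasi-periodicity of the Weierstrass zeta function together with Legendre's relation. -/
lemma PeriodPair.exists_wZeta_quasiperiod (P : PeriodPair) (h₁ : P.ω₁ ≠ 0)
    (him : 0 < (P.ω₂ / P.ω₁).im) :
    ∃ η : ℂ, ∀ z ∉ _root_.lattice P.ω₁ P.ω₂,
      wZeta P.ω₁ P.ω₂ (z + P.ω₁) = wZeta P.ω₁ P.ω₂ z + P.ω₁ * η ∧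
      wZeta P.ω₁ P.ω₂ (z + P.ω₂) = wZeta P.ω₁ P.ω₂ z + P.ω₂ * η - 2 * Real.pi * I / P.ω₁ := by
  set c : ℤ → ℂ := fun n ↦ ∑' m : ℤ, 1 / ((m : ℂ) * P.ω₁ + n * P.ω₂) ^ 2 with hc
  have hfst : ∀ z ∉ _root_.lattice P.ω₁ P.ω₂,
      HasSum c ((wZeta P.ω₁ P.ω₂ (z + P.ω₁) - wZeta P.ω₁ P.ω₂ z) / P.ω₁) := fun z hz ↦ by
    refine ((P.hasSum_wZeta_sub h₁ hz (add_fst_notMem_lattice hz)).div_const P.ω₁).congr_fun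
      fun n ↦ ?_
    have : cot (Real.pi * ((z + P.ω₁ - n * P.ω₂) / P.ω₁)) =
        cot (Real.pi * ((z - n * P.ω₂) / P.ω₁)) := by
      rw [show Real.pi * ((z + P.ω₁ - n * P.ω₂) / P.ω₁) =
        Real.pi * ((z - n * P.ω₂) / P.ω₁) + Real.pi by field_simp; ring]
      simp [cot, Complex.sin_add_pi, Complex.cos_add_pi]
    rw [this]
    change _ = (1 / P.ω₁ * _ + (z + P.ω₁ - z) * c n) / P.ω₁
    field_simp
    ring
  refine ⟨∑' n, c n, fun z hz ↦ ?_⟩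
  have hη := (hfst z hz).tsum_eq
  refine ⟨by rw [hη]; field_simp; ring, ?_⟩
  have hsum := (P.hasSum_wZeta_sub h₁ hz (add_snd_notMem_lattice hz)).sub
    ((hfst z hz).summable.hasSum.mul_left P.ω₂)
  let g : ℤ → ℂ := fun n ↦ 1 / P.ω₁ * (Real.pi * cot (Real.pi * ((z - n * P.ω₂) / P.ω₁)))
  have hg : HasSum (fun n ↦ g (n - 1) - g n) _ := hsum.congr_fun fun n ↦ by
    simp only [g, hc]
    rw [show z - ((n - 1 : ℤ) : ℂ) * P.ω₂ = z + P.ω₂ - n * P.ω₂ by push_cast; ring]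
    ring
  have him' : ∀ r : ℝ, ((z - r * P.ω₂) / P.ω₁).im = (z / P.ω₁).im - r * (P.ω₂ / P.ω₁).im := by
    intro r
    rw [sub_div, mul_div_assoc, sub_im, im_ofReal_mul]
  have hA : Tendsto (fun n : ℕ ↦ g (-n)) atTop (𝓝 (1 / P.ω₁ * (Real.pi * -I))) := by
    refine ((tendsto_cot_pi_mul_of_im_atTop
      (u := fun n : ℕ ↦ (z - ((-n : ℤ) : ℂ) * P.ω₂) / P.ω₁) ?_).const_mul _).const_mul _
    refine (tendsto_atTop_add_const_left _ (z / P.ω₁).im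
      (tendsto_natCast_atTop_atTop.atTop_mul_const him)).congr fun n ↦ ?_
    have := him' (-n)
    push_cast at this ⊢
    rw [this]
    ring
  have hB : Tendsto (fun n : ℕ ↦ g n) atTop (𝓝 (1 / P.ω₁ * (Real.pi * I))) := by
    refine ((tendsto_cot_pi_mul_of_im_atBot
      (u := fun n : ℕ ↦ (z - ((n : ℤ) : ℂ) * P.ω₂) / P.ω₁) ?_).const_mul _).const_mul _
    refine (tendsto_atBot_add_const_left _ (z / P.ω₁).im
      (tendsto_neg_atTop_atBot.comp (tendsto_natCast_atTop_atTop.atTop_mul_const him))).congr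
      fun n ↦ ?_
    have := him' n
    push_cast at this ⊢
    rw [this]
    simp only [Function.comp_apply]
    ring
  have := hg.eq_sub_of_int_telescoping hA hB
  linear_combination this

/-- An entire function with constant increments along two independent periods is affine, so the
increments are proportional to the periods. -/
lemma PeriodPair.exists_slope_of_additive (P : PeriodPair) {S : ℂ → ℂ} (hS : Differentiable ℂ S)
    {A B : ℂ} (hA : ∀ z, S (z + P.ω₁) = S z + A) (hB : ∀ z, S (z + P.ω₂) = S z + B) :
    ∃ c, A = P.ω₁ * c ∧ B = P.ω₂ * c := by
  have hder : ∀ {ω C : ℂ}, (∀ z, S (z + ω) = S z + C) → Function.Periodic (deriv S) ω := by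
    intro ω C h z
    rw [← deriv_comp_add_const, funext h, deriv_add_const]
  have hper : ∀ z w, w ∈ P.lattice → deriv S (z + w) = deriv S z := by
    intro z w hw
    obtain ⟨m, n, rfl⟩ := PeriodPair.mem_lattice.mp hw
    rw [← add_assoc, ((hder hB).int_mul n), ((hder hA).int_mul m)]
  have hcont : Continuous (deriv S) := (hS.contDiff (n := 1)).continuous_deriv le_rfl
  have hdiff : Differentiable ℂ (deriv S) := hS.deriv
  have hconst : ∀ z, deriv S z = deriv S 0 := fun z ↦
    hdiff.apply_eq_apply_of_bounded
      (IsZLattice.isCompact_range_of_periodic P.lattice _ hcont hper).isBounded z 0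
  have haff : ∀ z, S z = S 0 + z * deriv S 0 := by
    have hT : Differentiable ℂ fun z ↦ S z - z * deriv S 0 := by fun_prop
    have h0 : ∀ z, deriv (fun z ↦ S z - z * deriv S 0) z = 0 := fun z ↦ by
      rw [deriv_fun_sub (hS z) (by fun_prop), deriv_mul_const (by fun_prop)]
      simp [hconst z]
    intro z
    have := is_const_of_deriv_eq_zero hT h0 z 0
    simp at this
    linear_combination this
  refine ⟨deriv S 0, ?_, ?_⟩
  · have := hA 0
    rw [haff (0 + _)] at this
    linear_combination -this
  · have := hB 0
    rw [haff (0 + _)] at this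
    linear_combination -this

lemma countable_lattice (ω₁ ω₂ : ℂ) : (lattice ω₁ ω₂).Countable :=
  (Set.countable_range fun x : ℤ × ℤ ↦ (x.1 : ℂ) * ω₁ + x.2 * ω₂).mono
    (by rintro _ ⟨m, n, h⟩; exact ⟨(m, n), h.symm⟩)

lemma dense_setOf_forall_sub_notMem_lattice {ι : Type*} [Countable ι] (ω₁ ω₂ : ℂ) (p : ι → ℂ) :
    Dense {z : ℂ | ∀ j, z - p j ∉ lattice ω₁ ω₂} := by
  have : (⋃ j, (fun z ↦ z - p j) ⁻¹' lattice ω₁ ω₂).Countable :=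
    Set.countable_iUnion fun j ↦ (countable_lattice ω₁ ω₂).preimage (sub_left_injective)
  convert this.dense_compl ℝ using 1
  ext z
  simp

/-- variation of the conformal modulus `m(t) = ω₂(t)/(4πi)`:
`ṁ(t) = (1/(4π)) Σⱼ Lⱼ(t)`, where `ω₁ = 2π` and for each `t` the Loewner–Komatu field
`H_t` is `2π`-periodic, quasi-periodic with increment `−ω̇₂(t)`, and has the prescribed
principal parts `Lⱼ(t) ζ(z − pⱼ(t))` up to an entire function. -/
theorem modulus_derivative
    (Iv : Set ℝ) (hIv : Iv.OrdConnected) (ω₂ ω₂' : ℝ → ℂ)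
    (hω₂diff : ∀ t ∈ Iv, HasDerivWithinAt ω₂ (ω₂' t) Iv t)
    (hω₂im : ∀ t ∈ Iv, 0 < (ω₂ t).im)
    (N : ℕ) (p : Fin N → ℝ → ℂ) (L : Fin N → ℝ → ℂ) (H : ℝ → ℂ → ℂ)
    (hpmem : ∀ t ∈ Iv, ∀ j, p j t ∉ lattice (2 * (Real.pi : ℂ)) (ω₂ t))
    (hholo : ∀ t ∈ Iv, ∀ z : ℂ,
      (∀ j, z - p j t ∉ lattice (2 * (Real.pi : ℂ)) (ω₂ t)) → DifferentiableAt ℂ (H t) z)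
    (hper1 : ∀ t ∈ Iv, ∀ z : ℂ,
      (∀ j, z - p j t ∉ lattice (2 * (Real.pi : ℂ)) (ω₂ t)) →
      H t (z + 2 * (Real.pi : ℂ)) = H t z)
    (hper2 : ∀ t ∈ Iv, ∀ z : ℂ,
      (∀ j, z - p j t ∉ lattice (2 * (Real.pi : ℂ)) (ω₂ t)) →
      H t (z + ω₂ t) = H t z - ω₂' t)
    (hext : ∀ t ∈ Iv, ∃ S : ℂ → ℂ, Differentiable ℂ S ∧
      ∀ z : ℂ, (∀ j, z - p j t ∉ lattice (2 * (Real.pi : ℂ)) (ω₂ t)) →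
        S z = H t z - ∑ j, L j t * wZeta (2 * (Real.pi : ℂ)) (ω₂ t) (z - p j t)) :
    ∀ t ∈ Iv,
      HasDerivWithinAt (fun s => ω₂ s / (4 * (Real.pi : ℂ) * Complex.I))
        ((1 / (4 * (Real.pi : ℂ))) * ∑ j, L j t) Iv t := by
  intro t ht
  have hπ : (2 * (Real.pi : ℂ)) ≠ 0 := by simp [Real.pi_ne_zero]
  have him := hω₂im t ht
  let P : PeriodPair := ⟨2 * (Real.pi : ℂ), ω₂ t, by
    rw [LinearIndependent.pair_iff]
    intro a b hab
    have hi := congrArg Complex.im hab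
    have hr := congrArg Complex.re hab
    simp at hi hr
    have hb : b = 0 := hi.resolve_right him.ne'
    subst hb
    simpa [Real.pi_ne_zero] using hr⟩
  obtain ⟨η, hη⟩ := P.exists_wZeta_quasiperiod hπ (by
    change 0 < (ω₂ t / (2 * (Real.pi : ℂ))).im
    rw [← ofReal_ofNat, ← ofReal_mul, div_ofReal_im]
    have := Real.pi_pos
    positivity)
  obtain ⟨S, hS, hSH⟩ := hext t ht
  have hdense := dense_setOf_forall_sub_notMem_lattice (2 * (Real.pi : ℂ)) (ω₂ t) (p · t)
  have hSc := hS.continuous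
  have hA : ∀ z, S (z + P.ω₁) = S z + -(P.ω₁ * η * ∑ j, L j t) := by
    refine congrFun (Continuous.ext_on hdense (by fun_prop) (by fun_prop) fun z hz ↦ ?_)
    have hz' : ∀ j, z + P.ω₁ - p j t ∉ lattice (2 * (Real.pi : ℂ)) (ω₂ t) := fun j ↦ by
      rw [add_sub_right_comm]
      exact add_fst_notMem_lattice (hz j)
    have hsum : ∑ j, L j t * wZeta (2 * (Real.pi : ℂ)) (ω₂ t) (z + P.ω₁ - p j t) =
        ∑ j, L j t * wZeta (2 * (Real.pi : ℂ)) (ω₂ t) (z - p j t) + P.ω₁ * η * ∑ j, L j t := by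
      rw [Finset.mul_sum, ← Finset.sum_add_distrib]
      refine Finset.sum_congr rfl fun j _ ↦ ?_
      rw [add_sub_right_comm]
      linear_combination L j t * (hη _ (hz j)).1
    change S (z + P.ω₁) = S z + _
    rw [hSH _ hz', hSH _ hz, hsum, hper1 t ht z hz]
    ring
  have hB : ∀ z, S (z + P.ω₂) =
      S z + (-ω₂' t - (P.ω₂ * η - 2 * Real.pi * I / P.ω₁) * ∑ j, L j t) := by
    refine congrFun (Continuous.ext_on hdense (by fun_prop) (by fun_prop) fun z hz ↦ ?_)
    have hz' : ∀ j, z + P.ω₂ - p j t ∉ lattice (2 * (Real.pi : ℂ)) (ω₂ t) := fun j ↦ by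
      rw [add_sub_right_comm]
      exact add_snd_notMem_lattice (hz j)
    have hsum : ∑ j, L j t * wZeta (2 * (Real.pi : ℂ)) (ω₂ t) (z + P.ω₂ - p j t) =
        ∑ j, L j t * wZeta (2 * (Real.pi : ℂ)) (ω₂ t) (z - p j t) +
          (P.ω₂ * η - 2 * Real.pi * I / P.ω₁) * ∑ j, L j t := by
      rw [Finset.mul_sum, ← Finset.sum_add_distrib]
      refine Finset.sum_congr rfl fun j _ ↦ ?_
      rw [add_sub_right_comm]
      linear_combination L j t * (hη _ (hz j)).2
    change S (z + P.ω₂) = S z + _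
    rw [hSH _ hz', hSH _ hz, hsum, hper2 t ht z hz]
    ring
  obtain ⟨c, hc₁, hc₂⟩ := P.exists_slope_of_additive hS hA hB
  have hc : c = -(η * ∑ j, L j t) := mul_left_cancel₀ (show P.ω₁ ≠ 0 from hπ) (by
    rw [← hc₁]; ring)
  have hone : 2 * Real.pi * I / P.ω₁ = I := mul_div_cancel_left₀ I hπ
  have hω' : ω₂' t = I * ∑ j, L j t := by
    rw [hc, hone] at hc₂
    linear_combination -hc₂
  have hval : 1 / (4 * (Real.pi : ℂ)) * ∑ j, L j t = ω₂' t / (4 * (Real.pi : ℂ) * Complex.I) := by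
    have := ofReal_ne_zero.mpr Real.pi_ne_zero
    have := I_ne_zero
    rw [hω']
    field_simp
  rw [hval]
  exact (hω₂diff t ht).div_const (4 * (Real.pi : ℂ) * Complex.I)
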